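/- In a complete graph on k vertices with nonnegative edge weights a_1, ..., a_{n_k} (where n_k = k(k-1)/2 is the number of edges), for any cycle length r with 2 ≤ r ≤ k, the average gain over all cycles of length r satisfies (1/N_{r,k}) · Σ_{c ∈ C_k^{(r)}} G(c) ≤ ((a_1² + ... + a_{n_k}²)/n_k)^{r/2}, where N_{r,k} is the number of cycles of length r, and G(c) is the product of the edge weights of cycle c. -/

import Mathlib

open Finset

lemma two_ineq (p q p' q' : ℝ) (hp : 0 ≤ p) (hq : 0 ≤ q) (hp' : 0 ≤ p') (hq' : 0 ≤ q') :
    √p * √q + √p' * √q' ≤ 2 * (√((p + p') / 2) * √((q + q') / 2)) := by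
  have h1 : √((p + p') / 2) * √((q + q') / 2) = √(((p + p') / 2) * ((q + q') / 2)) := by
    rw [Real.sqrt_mul (by positivity)]
  rw [h1]
  have h2 : (√p * √q + √p' * √q') / 2 ≤ √(((p + p') / 2) * ((q + q') / 2)) := by
    apply Real.le_sqrt_of_sq_le
    obtain ⟨a, ha⟩ : ∃ a, a = √p := ⟨_, rfl⟩
    obtain ⟨b, hb⟩ : ∃ a, a = √q := ⟨_, rfl⟩
    obtain ⟨c, hc⟩ : ∃ a, a = √p' := ⟨_, rfl⟩
    obtain ⟨d, hd⟩ : ∃ a, a = √q' := ⟨_, rfl⟩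
    have e1 : p = a ^ 2 := by rw [ha, Real.sq_sqrt hp]
    have e2 : q = b ^ 2 := by rw [hb, Real.sq_sqrt hq]
    have e3 : p' = c ^ 2 := by rw [hc, Real.sq_sqrt hp']
    have e4 : q' = d ^ 2 := by rw [hd, Real.sq_sqrt hq']
    rw [← ha, ← hb, ← hc, ← hd, e1, e2, e3, e4]
    nlinarith [sq_nonneg (a * d - b * c)]
  linarith

lemma one_ineq (p p' : ℝ) (hp : 0 ≤ p) (hp' : 0 ≤ p') :
    √p + √p' ≤ 2 * √((p + p') / 2) := by
  have := two_ineq p 1 p' 1 hp zero_le_one hp' zero_le_one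
  have h1 : ((1:ℝ) + 1) / 2 = 1 := by norm_num
  rw [h1, Real.sqrt_one] at this
  linarith

/-- At most two factors differ. -/
lemma prod_ineq {ι : Type*} [DecidableEq ι] (T : Finset ι) (f g : ι → ℝ) (x y : ι)
    (hf : ∀ i, 0 ≤ f i) (hg : ∀ i, 0 ≤ g i)
    (h : ∀ i ∈ T, i ≠ x → i ≠ y → f i = g i) :
    ∏ i ∈ T, √(f i) + ∏ i ∈ T, √(g i) ≤ 2 * ∏ i ∈ T, √((f i + g i) / 2) := by
  set D := T ∩ {x, y} with hD
  have hDT : D ⊆ T := inter_subset_left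
  rw [← prod_sdiff hDT, ← prod_sdiff hDT, ← prod_sdiff hDT]
  have e1 : ∏ i ∈ T \ D, √(g i) = ∏ i ∈ T \ D, √(f i) := by
    apply prod_congr rfl
    intro i hi
    simp [hD] at hi
    rw [h i hi.1 (by tauto) (by tauto)]
  have e2 : ∏ i ∈ T \ D, √((f i + g i) / 2) = ∏ i ∈ T \ D, √(f i) := by
    apply prod_congr rfl
    intro i hi
    simp [hD] at hi
    rw [← h i hi.1 (by tauto) (by tauto)]
    ring_nf
  rw [e1, e2]
  have h0 : 0 ≤ ∏ i ∈ T \ D, √(f i) := prod_nonneg fun i _ => Real.sqrt_nonneg _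
  have key : ∏ i ∈ D, √(f i) + ∏ i ∈ D, √(g i) ≤ 2 * ∏ i ∈ D, √((f i + g i) / 2) := by
    have hc : #D ≤ 2 := (card_le_card inter_subset_right).trans card_le_two
    have : #D = 0 ∨ #D = 1 ∨ #D = 2 := by omega
    rcases this with hc | hc | hc
    · rw [card_eq_zero] at hc
      rw [hc]; norm_num
    · obtain ⟨z, hz⟩ := card_eq_one.1 hc
      rw [hz]; simp only [prod_singleton]
      exact one_ineq _ _ (hf _) (hg _)
    · obtain ⟨z, w, hzw, hz⟩ := card_eq_two.1 hc
      rw [hz]; simp only [prod_pair hzw]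
      exact two_ineq _ _ _ _ (hf _) (hf _) (hg _) (hg _)
  nlinarith [mul_le_mul_of_nonneg_left key h0]

/-- cyclic successor -/
def nx {r : ℕ} (i : Fin r) : Fin r := ⟨(i.val + 1) % r, Nat.mod_lt _ (by have := i.2; omega)⟩

lemma nx_val {r : ℕ} (i : Fin r) :
    ((nx i).val = i.val + 1 ∧ i.val + 1 < r) ∨ ((nx i).val = 0 ∧ i.val + 1 = r) := by
  have := i.2
  rcases Nat.lt_or_ge (i.val + 1) r with h | h
  · left; exact ⟨Nat.mod_eq_of_lt h, h⟩
  · right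
    have h' : i.val + 1 = r := by omega
    refine ⟨?_, h'⟩
    simp [nx, h']

lemma nx_inj {r : ℕ} : Function.Injective (nx : Fin r → Fin r) := by
  intro i j hij
  have hi := nx_val i
  have hj := nx_val j
  rw [hij] at hi
  apply Fin.ext
  omega

lemma nx_surj {r : ℕ} : Function.Surjective (nx : Fin r → Fin r) :=
  Finite.injective_iff_surjective.1 nx_inj

noncomputable def gain {k r : ℕ} (b : Fin k → Fin k → ℝ) (c : Fin r → Fin k) : ℝ :=
  ∏ i, √(b (c i) (c (nx i)))

noncomputable def tw {k : ℕ} (τ : Equiv.Perm (Fin k)) (b : Fin k → Fin k → ℝ) : Fin k → Fin k → ℝ :=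
  fun x y => (b x y + b (τ x) (τ y)) / 2

/-- reflection of the open block (s,t) -/
def vrefl {r : ℕ} (s t : Fin r) (j : Fin r) : Fin r :=
  if h : s < j ∧ j < t then ⟨s.val + t.val - j.val, by
    have := h.1; have := h.2; have := t.2; simp only [Fin.lt_def] at *; omega⟩ else j

lemma vrefl_val {r : ℕ} (s t j : Fin r) :
    (s.val < j.val ∧ j.val < t.val ∧ (vrefl s t j).val = s.val + t.val - j.val) ∨
    (¬ (s.val < j.val ∧ j.val < t.val) ∧ vrefl s t j = j) := by
  unfold vrefl
  by_cases h : s < j ∧ j < t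
  · left; rw [dif_pos h]; exact ⟨h.1, h.2, rfl⟩
  · right; rw [dif_neg h]; exact ⟨h, rfl⟩

lemma vrefl_vrefl {r : ℕ} (s t j : Fin r) : vrefl s t (vrefl s t j) = j := by
  have h1 := vrefl_val s t j
  have h2 := vrefl_val s t (vrefl s t j)
  apply Fin.ext
  rcases h1 with h1 | h1
  · rcases h2 with h2 | h2
    · omega
    · omega
  · rw [h1.2, h1.2]

/-- reflection of the edges of the block [s,t) -/
def erefl {r : ℕ} (s t : Fin r) (j : Fin r) : Fin r :=
  if h : s ≤ j ∧ j < t then ⟨s.val + t.val - 1 - j.val, by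
    have := h.1; have := h.2; have := t.2; simp only [Fin.lt_def] at *; omega⟩ else j

lemma erefl_val {r : ℕ} (s t j : Fin r) (h : s.val ≤ j.val ∧ j.val < t.val) :
    (erefl s t j).val = s.val + t.val - 1 - j.val := by
  unfold erefl
  rw [dif_pos (by exact h)]

/-- Two-position case, pointwise. -/
lemma four_ineq {k r : ℕ} (b : Fin k → Fin k → ℝ) (hb : ∀ x y, 0 ≤ b x y)
    (hs : ∀ x y, b x y = b y x) (u v : Fin k) (c : Fin r → Fin k) (s t : Fin r) (hst : s < t)
    (hc : ∀ i, (c i = u ∨ c i = v) ↔ (i = s ∨ i = t)) (hc' : c s ≠ c t) :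
    gain b c + gain b (Equiv.swap u v ∘ c) + gain b (c ∘ vrefl s t)
      + gain b (Equiv.swap u v ∘ (c ∘ vrefl s t)) ≤ 4 * gain (tw (Equiv.swap u v) b) c := by
  set τ := Equiv.swap u v with hτ
  have hst' : s.val < t.val := hst
  set T : Finset (Fin r) := univ.filter (fun i => s.val ≤ i.val ∧ i.val < t.val) with hT
  have hfix : ∀ i, i ≠ s → i ≠ t → τ (c i) = c i := by
    intro i h1 h2
    have := hc i
    exact Equiv.swap_apply_of_ne_of_ne (by tauto) (by tauto)
  have hsw : τ (c s) = c t ∧ τ (c t) = c s := by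
    have h1 := (hc s).2 (Or.inl rfl)
    have h2 := (hc t).2 (Or.inr rfl)
    rcases h1 with h1 | h1 <;> rcases h2 with h2 | h2
    · exact absurd (h1.trans h2.symm) hc'
    · rw [h1, h2]; simp [hτ]
    · rw [h1, h2]; simp [hτ]
    · exact absurd (h1.trans h2.symm) hc'
  -- half-path weights
  set A1 := ∏ i ∈ T, √(b (c i) (c (nx i))) with hA1
  set A2 := ∏ i ∈ univ \ T, √(b (c i) (c (nx i))) with hA2
  set B1 := ∏ i ∈ T, √(b (τ (c i)) (τ (c (nx i)))) with hB1
  set B2 := ∏ i ∈ univ \ T, √(b (τ (c i)) (τ (c (nx i)))) with hB2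
  have split : ∀ f : Fin r → ℝ, ∏ i, f i = (∏ i ∈ univ \ T, f i) * ∏ i ∈ T, f i :=
    fun f => (prod_sdiff (subset_univ T)).symm
  have g1 : gain b c = A2 * A1 := split _
  have g2 : gain b (τ ∘ c) = B2 * B1 := split _
  -- reflected point versus nonreflected, on T
  have hrev : ∀ i ∈ T, c (vrefl s t i) = τ (c (nx (erefl s t i))) ∧
      c (vrefl s t (nx i)) = τ (c (erefl s t i)) := by
    intro i hi
    simp only [hT, mem_filter, mem_univ, true_and] at hi
    have he := erefl_val s t i hi
    have hn := nx_val i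
    have hne := nx_val (erefl s t i)
    have ht := t.2
    constructor
    · rcases eq_or_ne i s with h | h
      · have e1 : nx (erefl s t i) = t := by apply Fin.ext; subst h; omega
        have e2 : vrefl s t i = s := by
          have := vrefl_val s t i
          apply Fin.ext; subst h; omega
        rw [e1, e2, hsw.2]
      · have h' : i.val ≠ s.val := fun hh => h (Fin.ext hh)
        have e2 : vrefl s t i = nx (erefl s t i) := by
          have := vrefl_val s t i
          apply Fin.ext; omega
        rw [← e2, hfix]
        · intro hh; rw [e2] at hh; rw [hh] at hne; omega
        · intro hh; rw [e2] at hh; rw [hh] at hne; omega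
    · rcases eq_or_ne (nx i) t with h | h
      · have e1 : erefl s t i = s := by
          apply Fin.ext; rw [h] at hn; omega
        have e2 : vrefl s t (nx i) = t := by
          have := vrefl_val s t (nx i)
          rw [h] at this ⊢
          rcases this with this | this
          · omega
          · exact this.2
        rw [e1, e2, hsw.1]
      · have h' : (nx i).val ≠ t.val := fun hh => h (Fin.ext hh)
        have e2 : vrefl s t (nx i) = erefl s t i := by
          have := vrefl_val s t (nx i)
          apply Fin.ext; omega
        rw [e2, hfix]
        · intro hh; rw [hh] at he; omega
        · intro hh; rw [hh] at he; omega
  have hout : ∀ i ∈ univ \ T, vrefl s t i = i ∧ vrefl s t (nx i) = nx i := by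
    intro i hi
    simp only [hT, mem_sdiff, mem_filter, mem_univ, true_and] at hi
    have h1 := vrefl_val s t i
    have h2 := vrefl_val s t (nx i)
    have hn := nx_val i
    constructor
    · rcases h1 with h1 | h1
      · omega
      · exact h1.2
    · rcases h2 with h2 | h2
      · omega
      · exact h2.2
  have hTmem : ∀ i ∈ T, erefl s t i ∈ T := by
    intro i hi
    simp only [hT, mem_filter, mem_univ, true_and] at hi ⊢
    have he := erefl_val s t i hi
    omega
  have hTinv : ∀ i ∈ T, erefl s t (erefl s t i) = i := by
    intro i hi
    have h2 := hTmem i hi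
    simp only [hT, mem_filter, mem_univ, true_and] at hi h2
    have he := erefl_val s t i hi
    have he' := erefl_val s t _ h2
    apply Fin.ext; omega
  have reidx : ∀ f : Fin r → ℝ, ∏ i ∈ T, f (erefl s t i) = ∏ i ∈ T, f i := by
    intro f
    exact prod_nbij' (erefl s t) (erefl s t) hTmem hTmem hTinv hTinv (fun _ _ => rfl)
  have hττ : ∀ x, τ (τ x) = x := fun x => by simp [hτ]
  have g3 : gain b (c ∘ vrefl s t) = A2 * B1 := by
    unfold gain
    rw [split, hA2, hB1, ← reidx (fun i => √(b (τ (c i)) (τ (c (nx i)))))]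
    congr 1
    · apply prod_congr rfl
      intro i hi
      simp only [Function.comp, (hout i hi).1, (hout i hi).2]
    · apply prod_congr rfl
      intro i hi
      simp only [Function.comp, (hrev i hi).1, (hrev i hi).2]
      rw [hs]
  have g4 : gain b (τ ∘ (c ∘ vrefl s t)) = B2 * A1 := by
    unfold gain
    rw [split, hB2, hA1, ← reidx (fun i => √(b (c i) (c (nx i))))]
    congr 1
    · apply prod_congr rfl
      intro i hi
      simp only [Function.comp, (hout i hi).1, (hout i hi).2]
    · apply prod_congr rfl
      intro i hi
      simp only [Function.comp, (hrev i hi).1, (hrev i hi).2, hττ]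
      rw [hs]
  have g5 : gain (tw τ b) c = (∏ i ∈ univ \ T, √((b (c i) (c (nx i)) + b (τ (c i)) (τ (c (nx i)))) / 2))
      * ∏ i ∈ T, √((b (c i) (c (nx i)) + b (τ (c i)) (τ (c (nx i)))) / 2) := split _
  obtain ⟨ps, hps⟩ := nx_surj s
  obtain ⟨pt, hpt⟩ := nx_surj t
  have i1 : A1 + B1 ≤ 2 * ∏ i ∈ T, √((b (c i) (c (nx i)) + b (τ (c i)) (τ (c (nx i)))) / 2) := by
    apply prod_ineq T (fun i => b (c i) (c (nx i))) (fun i => b (τ (c i)) (τ (c (nx i)))) s pt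
      (fun _ => hb _ _) (fun _ => hb _ _)
    intro i hi h1 h2
    simp only [hT, mem_filter, mem_univ, true_and] at hi
    have hn := nx_val i
    have ht := t.2
    have hnt : nx i ≠ t := fun hh => h2 (nx_inj (hh.trans hpt.symm))
    have hit : i ≠ t := fun hh => by rw [hh] at hi; omega
    have hns : nx i ≠ s := fun hh => by rw [hh] at hn; omega
    simp only [hfix i h1 hit, hfix _ hns hnt]
  have i2 : A2 + B2 ≤ 2 * ∏ i ∈ univ \ T, √((b (c i) (c (nx i)) + b (τ (c i)) (τ (c (nx i)))) / 2) := by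
    apply prod_ineq (univ \ T) (fun i => b (c i) (c (nx i))) (fun i => b (τ (c i)) (τ (c (nx i)))) t ps
      (fun _ => hb _ _) (fun _ => hb _ _)
    intro i hi h1 h2
    simp only [hT, mem_sdiff, mem_filter, mem_univ, true_and] at hi
    have hn := nx_val i
    have hns : nx i ≠ s := fun hh => h2 (nx_inj (hh.trans hps.symm))
    have his : i ≠ s := fun hh => by rw [hh] at hi; omega
    have h1' : i.val ≠ t.val := fun hh => h1 (Fin.ext hh)
    have hnt : nx i ≠ t := fun hh => by rw [hh] at hn; omega
    simp only [hfix i his h1, hfix _ hns hnt]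
  rw [g1, g2, g3, g4, g5]
  have p1 : 0 ≤ A1 + B1 := add_nonneg (prod_nonneg fun i _ => Real.sqrt_nonneg _)
    (prod_nonneg fun i _ => Real.sqrt_nonneg _)
  have p2 : 0 ≤ A2 + B2 := add_nonneg (prod_nonneg fun i _ => Real.sqrt_nonneg _)
    (prod_nonneg fun i _ => Real.sqrt_nonneg _)
  have := mul_le_mul i2 i1 p1 (p2.trans i2)
  nlinarith [this]

lemma two_gain {k r : ℕ} (b : Fin k → Fin k → ℝ) (hb : ∀ x y, 0 ≤ b x y)
    (u v : Fin k) (c : Fin r → Fin k) (s : Fin r)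
    (hc : ∀ i, (c i = u ∨ c i = v) → i = s) :
    gain b c + gain b (Equiv.swap u v ∘ c) ≤ 2 * gain (tw (Equiv.swap u v) b) c := by
  obtain ⟨ps, hps⟩ := nx_surj s
  have hfix : ∀ i, i ≠ s → Equiv.swap u v (c i) = c i := by
    intro i h1
    have := hc i
    exact Equiv.swap_apply_of_ne_of_ne (by tauto) (by tauto)
  refine prod_ineq univ (fun i => b (c i) (c (nx i)))
    (fun i => b (Equiv.swap u v (c i)) (Equiv.swap u v (c (nx i)))) s ps
      (fun _ => hb _ _) (fun _ => hb _ _) ?_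
  intro i _ h1 h2
  have hns : nx i ≠ s := fun hh => h2 (nx_inj (hh.trans hps.symm))
  simp only [hfix i h1, hfix _ hns]

def injs (k r : ℕ) : Finset (Fin r → Fin k) :=
  univ.filter (fun c : Fin r → Fin k => Function.Injective c)

def ky {k r : ℕ} (u v : Fin k) (c : Fin r → Fin k) : Finset (Fin r) :=
  univ.filter (fun i => c i = u ∨ c i = v)

lemma ky_swap {k r : ℕ} (u v : Fin k) (c : Fin r → Fin k) :
    ky u v (Equiv.swap u v ∘ c) = ky u v c := by
  ext i
  simp only [ky, mem_filter, mem_univ, true_and, Function.comp]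
  rw [Equiv.swap_apply_eq_iff, Equiv.swap_apply_eq_iff, Equiv.swap_apply_left,
    Equiv.swap_apply_right]
  tauto

lemma sum_gain_le {k r : ℕ} (hr : 2 ≤ r) (b : Fin k → Fin k → ℝ) (hb : ∀ x y, 0 ≤ b x y)
    (hs : ∀ x y, b x y = b y x) (u v : Fin k) :
    ∑ c ∈ injs k r, gain b c ≤ ∑ c ∈ injs k r, gain (tw (Equiv.swap u v) b) c := by
  rw [← sum_fiberwise (injs k r) (ky u v) (gain b),
    ← sum_fiberwise (injs k r) (ky u v) (gain (tw (Equiv.swap u v) b))]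
  apply sum_le_sum
  intro S _
  set J := (injs k r).filter (fun c => ky u v c = S) with hJ
  have hJm : ∀ c, c ∈ J ↔ Function.Injective c ∧ ky u v c = S := by
    intro c; simp [hJ, injs]
  have hsw : ∀ c ∈ J, Equiv.swap u v ∘ c ∈ J := by
    intro c hc
    rw [hJm] at hc ⊢
    exact ⟨(Equiv.injective _).comp hc.1, by rw [ky_swap]; exact hc.2⟩
  have hsw2 : ∀ c : Fin r → Fin k, Equiv.swap u v ∘ (Equiv.swap u v ∘ c) = c := by
    intro c; ext i; simp
  have e1 : ∀ f : (Fin r → Fin k) → ℝ, ∑ c ∈ J, f (Equiv.swap u v ∘ c) = ∑ c ∈ J, f c := by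
    intro f
    exact sum_nbij' (fun c => Equiv.swap u v ∘ c) (fun c => Equiv.swap u v ∘ c) hsw hsw
      (fun c _ => hsw2 c) (fun c _ => hsw2 c) (fun _ _ => rfl)
  by_cases hS : ∃ s t, s < t ∧ S = {s, t}
  · obtain ⟨s, t, hst, rfl⟩ := hS
    have hkey : ∀ c ∈ J, ∀ i, (c i = u ∨ c i = v) ↔ (i = s ∨ i = t) := by
      intro c hc i
      have h2 := ((hJm c).1 hc).2
      have : i ∈ ky u v c ↔ i ∈ ({s, t} : Finset (Fin r)) := by rw [h2]
      simpa [ky] using this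
    have hvs : vrefl s t s = s := by
      rcases vrefl_val s t s with h | h
      · omega
      · exact h.2
    have hvt : vrefl s t t = t := by
      rcases vrefl_val s t t with h | h
      · omega
      · exact h.2
    have hrf : ∀ c ∈ J, c ∘ vrefl s t ∈ J := by
      intro c hc
      rw [hJm]
      refine ⟨((hJm c).1 hc).1.comp (Function.LeftInverse.injective (vrefl_vrefl s t)), ?_⟩
      ext i
      simp only [ky, mem_filter, mem_univ, true_and, Function.comp, mem_insert, mem_singleton]
      rw [hkey c hc]
      constructor
      · rintro (h | h)
        · left; rw [← vrefl_vrefl s t i, h, hvs]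
        · right; rw [← vrefl_vrefl s t i, h, hvt]
      · rintro (h | h)
        · left; rw [h, hvs]
        · right; rw [h, hvt]
    have hrf2 : ∀ c : Fin r → Fin k, (c ∘ vrefl s t) ∘ vrefl s t = c := by
      intro c; funext i; simp [vrefl_vrefl]
    have e2 : ∀ f : (Fin r → Fin k) → ℝ, ∑ c ∈ J, f (c ∘ vrefl s t) = ∑ c ∈ J, f c := by
      intro f
      exact sum_nbij' (fun c => c ∘ vrefl s t) (fun c => c ∘ vrefl s t) hrf hrf
        (fun c _ => hrf2 c) (fun c _ => hrf2 c) (fun _ _ => rfl)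
    have main : ∑ c ∈ J, (gain b c + gain b (Equiv.swap u v ∘ c) + gain b (c ∘ vrefl s t)
      + gain b (Equiv.swap u v ∘ (c ∘ vrefl s t))) ≤
        ∑ c ∈ J, 4 * gain (tw (Equiv.swap u v) b) c := by
      apply sum_le_sum
      intro c hc
      exact four_ineq b hb hs u v c s t hst (hkey c hc)
        (fun h => hst.ne (((hJm c).1 hc).1 h))
    rw [sum_add_distrib, sum_add_distrib, sum_add_distrib, ← mul_sum, e1 (gain b),
      e2 (fun c => gain b (Equiv.swap u v ∘ c)), e2 (gain b), e1 (gain b)] at main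
    linarith
  · have main : ∑ c ∈ J, (gain b c + gain b (Equiv.swap u v ∘ c)) ≤
        ∑ c ∈ J, 2 * gain (tw (Equiv.swap u v) b) c := by
      apply sum_le_sum
      intro c hc
      have hone : ∃ s : Fin r, ∀ i, (c i = u ∨ c i = v) → i = s := by
        by_cases hne : ∃ s, c s = u ∨ c s = v
        · obtain ⟨s, hs1⟩ := hne
          refine ⟨s, fun i hi => ?_⟩
          by_contra his
          apply hS
          obtain ⟨hinj, hk⟩ := (hJm c).1 hc
          have hall : S = {s, i} := by
            rw [← hk]
            ext j
            simp only [ky, mem_filter, mem_univ, true_and, mem_insert, mem_singleton]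
            constructor
            · intro hj
              by_contra hcon
              push Not at hcon
              have h1 : c s ≠ c i := fun h => his (hinj h).symm
              have h2 : c j ≠ c s := fun h => hcon.1 (hinj h)
              have h3 : c j ≠ c i := fun h => hcon.2 (hinj h)
              rcases hs1 with a | a <;> rcases hi with b | b <;> rcases hj with d | d <;>
                simp_all
            · rintro (h | h)
              · rw [h]; exact hs1
              · rw [h]; exact hi
          rcases lt_or_gt_of_ne his with h | h
          · exact ⟨i, s, h, by rw [hall, pair_comm]⟩
          · exact ⟨s, i, h, hall⟩
        · push Not at hne
          exact ⟨⟨0, by omega⟩, fun i hi => absurd hi (by have := hne i; tauto)⟩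
      obtain ⟨s, hs1⟩ := hone
      exact two_gain b hb u v c s hs1
    rw [sum_add_distrib, ← mul_sum, e1 (gain b)] at main
    linarith

lemma const_of_swap {k : ℕ} (b : Fin k → Fin k → ℝ) (hs : ∀ x y, b x y = b y x)
    (h : ∀ u v x y, b (Equiv.swap u v x) (Equiv.swap u v y) = b x y)
    (x y x' y' : Fin k) (hxy : x ≠ y) (hxy' : x' ≠ y') : b x y = b x' y' := by
  have step : ∀ p q w : Fin k, w ≠ p → w ≠ q → b p w = b q w := by
    intro p q w h1 h2
    have := h p q p w
    rw [Equiv.swap_apply_left, Equiv.swap_apply_of_ne_of_ne h1 h2] at this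
    exact this.symm
  by_cases hc : x' = y
  · subst hc
    rw [step x y' x' hxy.symm hxy', hs]
  · rw [step x x' y hxy.symm (Ne.symm hc), hs, step y y' x' hc hxy', hs]

lemma exists_const_weights {k r : ℕ} (hr : 2 ≤ r) (b : Fin k → Fin k → ℝ) (hb : ∀ x y, 0 ≤ b x y)
    (hs : ∀ x y, b x y = b y x) (hd : ∀ x, b x x = 0) :
    ∃ b' : Fin k → Fin k → ℝ, (∀ x y, 0 ≤ b' x y) ∧ (∀ x, b' x x = 0) ∧
      (∑ x, ∑ y, b' x y = ∑ x, ∑ y, b x y) ∧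
      (∑ c ∈ injs k r, gain b c ≤ ∑ c ∈ injs k r, gain b' c) ∧
      (∀ x y x' y', x ≠ y → x' ≠ y' → b' x y = b' x' y') := by
  set S := ∑ x, ∑ y, b x y with hS
  set K : Set (Fin k → Fin k → ℝ) := {w | (∀ x y, 0 ≤ w x y) ∧ (∀ x y, w x y = w y x) ∧
    (∀ x, w x x = 0) ∧ (∑ x, ∑ y, w x y = S) ∧
    (∑ c ∈ injs k r, gain b c ≤ ∑ c ∈ injs k r, gain w c)} with hK
  have hcl : IsClosed K := by
    simp only [hK, Set.setOf_and, Set.setOf_forall]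
    refine IsClosed.inter ?_ (IsClosed.inter ?_ (IsClosed.inter ?_ (IsClosed.inter ?_ ?_)))
    · exact isClosed_iInter fun x => isClosed_iInter fun y =>
        isClosed_le continuous_const (by fun_prop)
    · exact isClosed_iInter fun x => isClosed_iInter fun y =>
        isClosed_eq (by fun_prop) (by fun_prop)
    · exact isClosed_iInter fun x => isClosed_eq (by fun_prop) (by fun_prop)
    · exact isClosed_eq (by fun_prop) (by fun_prop)
    · unfold gain
      exact isClosed_le continuous_const (by fun_prop)
  have hcomp : IsCompact K := by
    refine IsCompact.of_isClosed_subset (isCompact_Icc (a := fun _ _ => 0) (b := fun _ _ => S)) hcl ?_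
    rintro w ⟨h1, _, _, h4, _⟩
    refine ⟨fun x y => h1 x y, fun x y => ?_⟩
    rw [← h4]
    calc w x y ≤ ∑ y, w x y := single_le_sum (f := fun y => w x y) (fun i _ => h1 x i) (mem_univ y)
      _ ≤ _ := single_le_sum (f := fun x => ∑ y, w x y)
          (fun i _ => sum_nonneg fun j _ => h1 i j) (mem_univ x)
  have hne : K.Nonempty := ⟨b, hb, hs, hd, rfl, le_rfl⟩
  obtain ⟨w, hw, hmin⟩ := hcomp.exists_isMinOn hne
    (f := fun w : Fin k → Fin k → ℝ => ∑ x, ∑ y, (w x y) ^ 2) (by fun_prop)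
  obtain ⟨h1, h2, h3, h4, h5⟩ := hw
  refine ⟨w, h1, h3, h4, h5, ?_⟩
  apply fun hh x y x' y' => const_of_swap w h2 hh x y x' y'
  intro u v
  set τ := Equiv.swap u v with hτ
  have re : ∀ f : Fin k → Fin k → ℝ, ∑ x, ∑ y, f (τ x) (τ y) = ∑ x, ∑ y, f x y := by
    intro f
    rw [Equiv.sum_comp τ (fun x => ∑ y, f x (τ y))]
    exact sum_congr rfl fun x _ => Equiv.sum_comp τ (fun y => f x y)
  have hmem : tw τ w ∈ K := by
    refine ⟨fun x y => ?_, fun x y => ?_, fun x => ?_, ?_, ?_⟩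
    · exact div_nonneg (add_nonneg (h1 _ _) (h1 _ _)) zero_le_two
    · simp only [tw]; rw [h2 x y, h2 (τ x)]
    · simp [tw, h3]
    · simp only [tw, ← sum_div, sum_add_distrib]
      rw [re w, h4]; ring
    · exact h5.trans (sum_gain_le hr w h1 h2 u v)
  have hle : ∑ x, ∑ y, (w x y) ^ 2 ≤ ∑ x, ∑ y, (tw τ w x y) ^ 2 := hmin hmem
  have hid : ∑ x, ∑ y, (tw τ w x y) ^ 2 + ∑ x, ∑ y, ((w (τ x) (τ y) - w x y) / 2) ^ 2 =
      ∑ x, ∑ y, (w x y) ^ 2 := by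
    have e : ∑ x, ∑ y, (tw τ w x y) ^ 2 + ∑ x, ∑ y, ((w (τ x) (τ y) - w x y) / 2) ^ 2 =
      (∑ x, ∑ y, (w x y) ^ 2 + ∑ x, ∑ y, (w (τ x) (τ y)) ^ 2) / 2 := by
      simp only [← sum_add_distrib, sum_div, tw]
      exact sum_congr rfl fun x _ => sum_congr rfl fun y _ => by ring
    rw [e, re (fun x y => (w x y) ^ 2)]; ring
  have hz : ∑ x, ∑ y, ((w (τ x) (τ y) - w x y) / 2) ^ 2 = 0 :=
    le_antisymm (by linarith) (sum_nonneg fun _ _ => sum_nonneg fun _ _ => sq_nonneg _)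
  intro x y
  rw [sum_eq_zero_iff_of_nonneg (fun _ _ => sum_nonneg fun _ _ => sq_nonneg _)] at hz
  have hz1 := hz x (mem_univ x)
  rw [sum_eq_zero_iff_of_nonneg (fun _ _ => sq_nonneg _)] at hz1
  have hz2 := pow_eq_zero_iff (two_ne_zero) |>.1 (hz1 y (mem_univ y))
  linarith

lemma card_injs (k r : ℕ) : #(injs k r) = k.descFactorial r := by
  have := Fintype.card_embedding_eq (α := Fin r) (β := Fin k)
  simp only [Fintype.card_fin] at this
  rw [← this, injs, ← Fintype.card_subtype]
  exact Fintype.card_congr (Equiv.subtypeInjectiveEquivEmbedding _ _)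



/-- Lemma 1 (graph cycle gain bound): in a complete graph on `k` vertices with
nonnegative symmetric edge weights `a`, the average gain over all cycles of length `r`
is at most `((Σ edge weights squared)/n_k)^{r/2}`. Cycles of length `r` are represented
by injective maps `Fin r → Fin k`; each unrooted undirected cycle corresponds to exactly
`2r` such maps with the same gain, so dividing the sum over injective maps by
`2·r·N_{r,k}` with `N_{r,k} = C(k,r)(r-1)!/2` yields the average gain over cycles. -/
theorem stmt_0 (k r : ℕ) (hr : 2 ≤ r) (hrk : r ≤ k)
    (a : Fin k → Fin k → ℝ) (ha : ∀ i j, 0 ≤ a i j)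
    (hsymm : ∀ i j, a i j = a j i) :
    (∑ c ∈ Finset.univ.filter (fun c : Fin r → Fin k => Function.Injective c),
        ∏ i : Fin r, a (c i) (c ⟨(i.val + 1) % r, Nat.mod_lt _ (by omega)⟩)) /
      (2 * r * ((Nat.choose k r * Nat.factorial (r - 1) : ℝ) / 2)) ≤
    ((∑ i : Fin k, ∑ j ∈ Finset.univ.filter (fun j => i < j), (a i j) ^ 2) /
        (Nat.choose k 2 : ℝ)) ^ ((r : ℝ) / 2) := by
  set b : Fin k → Fin k → ℝ := fun x y => if x = y then 0 else (a x y) ^ 2 with hbdef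
  have hb : ∀ x y, 0 ≤ b x y := by
    intro x y; simp only [hbdef]; split_ifs
    · exact le_rfl
    · positivity
  have hs : ∀ x y, b x y = b y x := by
    intro x y; simp only [hbdef, hsymm x y, eq_comm]
  have hd : ∀ x, b x x = 0 := by intro x; simp [hbdef]
  obtain ⟨w, h1, h3, h4, h5, h6⟩ := exists_const_weights hr b hb hs hd
  have hnx : ∀ i : Fin r, nx i ≠ i := by
    intro i h
    have := nx_val i
    rw [h] at this
    omega
  obtain ⟨β, hβ⟩ : ∃ β, β = w ⟨0, by omega⟩ ⟨1, by omega⟩ := ⟨_, rfl⟩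
  have hw : ∀ x y, x ≠ y → w x y = β := by
    intro x y hxy
    rw [hβ]
    exact h6 _ _ _ _ hxy (by simp [Fin.ext_iff])
  have hβ0 : 0 ≤ β := by rw [hβ]; exact h1 _ _
  have hL : ∑ c ∈ Finset.univ.filter (fun c : Fin r → Fin k => Function.Injective c),
        ∏ i : Fin r, a (c i) (c ⟨(i.val + 1) % r, Nat.mod_lt _ (by omega)⟩) =
      ∑ c ∈ injs k r, gain b c := by
    apply sum_congr rfl
    intro c hc
    have hinj : Function.Injective c := by simpa using hc
    apply prod_congr rfl
    intro i _
    have hne : c i ≠ c (nx i) := fun h => hnx i (hinj h).symm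
    simp only [hbdef, if_neg hne]
    rw [Real.sqrt_sq (ha _ _)]
    rfl
  have hR : ∑ c ∈ injs k r, gain w c = (k.descFactorial r : ℝ) * √β ^ r := by
    rw [← card_injs, ← nsmul_eq_mul, ← sum_const]
    apply sum_congr rfl
    intro c hc
    have hinj : Function.Injective c := by simpa [injs] using hc
    unfold gain
    rw [prod_congr rfl (g := fun _ => √β)]
    · simp
    · intro i _
      rw [hw _ _ (fun h => hnx i (hinj h).symm)]
  have hsumw : ∑ x, ∑ y, w x y = k * (k - 1) * β := by
    have : ∀ x, ∑ y, w x y = (k - 1) * β := by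
      intro x
      rw [← add_sum_erase _ _ (mem_univ x), h3, zero_add,
        sum_congr rfl (g := fun _ => β) (fun y hy => hw x y (ne_of_mem_erase hy).symm)]
      rw [sum_const, card_erase_of_mem (mem_univ x), nsmul_eq_mul]
      simp only [card_univ, Fintype.card_fin]
      rw [Nat.cast_sub (by omega)]; simp
    simp only [this, sum_const, nsmul_eq_mul, card_univ, Fintype.card_fin]
    ring
  have hsumb : ∑ x, ∑ y, b x y =
      2 * ∑ i : Fin k, ∑ j ∈ Finset.univ.filter (fun j => i < j), (a i j) ^ 2 := by
    have e1 : ∀ x y, b x y = (if x < y then (a x y) ^ 2 else 0) + (if y < x then (a y x) ^ 2 else 0) := by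
      intro x y
      simp only [hbdef]
      rcases lt_trichotomy x y with h | h | h
      · simp [h, h.ne, h.not_gt]
      · simp [h]
      · simp [h, h.ne', h.not_gt, hsymm x y]
    simp only [e1, sum_add_distrib]
    rw [sum_comm (f := fun x y => if y < x then (a y x) ^ 2 else 0)]
    simp only [sum_filter]
    ring
  have hk : (Nat.choose k 2 : ℝ) = k * (k - 1) / 2 := Nat.cast_choose_two ℝ k
  have hk2 : (2 : ℝ) ≤ k := by exact_mod_cast hr.trans hrk
  have hmean : (∑ i : Fin k, ∑ j ∈ Finset.univ.filter (fun j => i < j), (a i j) ^ 2) /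
        (Nat.choose k 2 : ℝ) = β := by
    have hpos : (0 : ℝ) < k * (k - 1) := by nlinarith
    rw [hk, div_eq_iff (by positivity)]
    linarith
  have hden : (2 * r * ((Nat.choose k r * Nat.factorial (r - 1) : ℝ) / 2)) = k.descFactorial r := by
    rw [Nat.descFactorial_eq_factorial_mul_choose, ← Nat.mul_factorial_pred (by omega : r ≠ 0)]
    push_cast
    ring
  have hdp : (0 : ℝ) < k.descFactorial r := by
    exact_mod_cast Nat.descFactorial_pos.2 hrk
  rw [hmean, hden, hL, div_le_iff₀ hdp]
  have hpow : β ^ ((r : ℝ) / 2) = √β ^ r := by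
    rw [Real.sqrt_eq_rpow, ← Real.rpow_natCast, ← Real.rpow_mul hβ0]
    congr 1; ring
  rw [hpow]
  linarith
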